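/- arXiv:2507.15475 — 6 statements merged into one kernel-verified Lean document; each statement's English description precedes it below -/
import Mathlib

section
/- For every real r with 2·cos a ≤ r ≤ 2, the probability under the product measure μ_a ⊗ μ_a of the set {(φ₁, φ₂) ∈ ℝ² : |e^{iφ₁} + e^{iφ₂}| ≤ r} equals (a − arccos(r/2))² / a². -/
open MeasureTheory Real

/-- The uniform probability measure on the interval `[-a, a]`:
Lebesgue measure restricted to `[-a, a]`, normalized by `1/(2a)`. -/
noncomputable def mu (a : ℝ) : Measure ℝ :=
  (ENNReal.ofReal (2 * a))⁻¹ • volume.restrict (Set.Icc (-a) a)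

theorem norm_exp_mul_I_add_exp_mul_I (x y : ℝ) :
    ‖Complex.exp ((x : ℂ) * Complex.I) + Complex.exp ((y : ℂ) * Complex.I)‖
      = 2 * |Real.cos ((x - y) / 2)| := by
  have h : Complex.exp ((x : ℂ) * Complex.I) + Complex.exp ((y : ℂ) * Complex.I)
      = Complex.exp ((((x + y) / 2 : ℝ) : ℂ) * Complex.I)
        * ((2 * Real.cos ((x - y) / 2) : ℝ) : ℂ) := by
    push_cast
    rw [Complex.two_cos, mul_add, ← Complex.exp_add, ← Complex.exp_add]
    ring_nf
  rw [h, norm_mul, Complex.norm_exp_ofReal_mul_I, one_mul, Complex.norm_real, Real.norm_eq_abs,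
    abs_mul, abs_two]

theorem two_mul_abs_cos_half_le_iff {d r : ℝ} (hd : |d| ≤ π) (hr0 : 0 ≤ r) (hr2 : r ≤ 2) :
    2 * |Real.cos (d / 2)| ≤ r ↔ 2 * Real.arccos (r / 2) ≤ |d| := by
  have hcos : Real.cos (d / 2) = Real.cos (|d| / 2) := by
    rw [← Real.cos_abs (d / 2), abs_div, abs_two]
  have hd0 := abs_nonneg d
  have hmem : |d| / 2 ∈ Set.Icc 0 π := ⟨by linarith, by linarith⟩
  have hnn : 0 ≤ Real.cos (|d| / 2) :=
    Real.cos_nonneg_of_mem_Icc ⟨by linarith [Real.pi_pos], by linarith⟩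
  have hr : Real.cos (Real.arccos (r / 2)) = r / 2 :=
    Real.cos_arccos (by linarith) (by linarith)
  have key := Real.strictAntiOn_cos.le_iff_ge hmem
    (⟨Real.arccos_nonneg (r / 2), Real.arccos_le_pi _⟩ : Real.arccos (r / 2) ∈ Set.Icc 0 π)
  rw [hr] at key
  rw [hcos, abs_of_nonneg hnn]
  constructor
  · intro h
    linarith [key.1 (by linarith)]
  · intro h
    linarith [key.2 (by linarith)]

theorem setLIntegral_ofReal_sub_const {a b c : ℝ} (hac : a ≤ c) (hcb : c ≤ b) :
    ∫⁻ x in Set.Icc a b, ENNReal.ofReal (x - c) = ENNReal.ofReal ((b - c) ^ 2 / 2) := by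
  have hzero : ∫⁻ x in Set.Ico a c, ENNReal.ofReal (x - c) = 0 := by
    rw [setLIntegral_congr_fun (g := fun _ => 0) measurableSet_Ico, lintegral_zero]
    intro x hx
    exact ENNReal.ofReal_of_nonpos (by linarith [hx.2])
  have hpos : ∫⁻ x in Set.Icc c b, ENNReal.ofReal (x - c) = ENNReal.ofReal ((b - c) ^ 2 / 2) := by
    rw [← ofReal_integral_eq_lintegral_ofReal]
    · rw [integral_Icc_eq_integral_Ioc, ← intervalIntegral.integral_of_le hcb]
      simp only [intervalIntegral.integral_comp_sub_right (fun x => x), integral_id]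
      ring_nf
    · exact (by fun_prop : Continuous fun x : ℝ => x - c).integrableOn_Icc
    · filter_upwards [ae_restrict_mem measurableSet_Icc] with x hx
      exact sub_nonneg.2 hx.1
  rw [← Set.Ico_union_Icc_eq_Icc hac hcb, lintegral_union measurableSet_Icc, hzero, hpos, zero_add]
  exact Set.disjoint_left.2 fun x hx hx' => absurd hx.2 (not_lt.2 hx'.1)

theorem setLIntegral_ofReal_const_sub {a b c : ℝ} (hac : a ≤ c) (hcb : c ≤ b) :
    ∫⁻ x in Set.Icc a b, ENNReal.ofReal (c - x) = ENNReal.ofReal ((c - a) ^ 2 / 2) := by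
  have h := (Measure.measurePreserving_neg (volume : Measure ℝ)).setLIntegral_comp_preimage_emb
    (MeasurableEquiv.neg ℝ).measurableEmbedding (fun x => ENNReal.ofReal (c - x)) (Set.Icc a b)
  rw [← h]
  have hset : (Neg.neg : ℝ → ℝ) ⁻¹' Set.Icc a b = Set.Icc (-b) (-a) := by simp
  rw [hset]
  have := setLIntegral_ofReal_sub_const (neg_le_neg hcb) (neg_le_neg hac)
  convert this using 3
  all_goals ring_nf

theorem restrict_prod_restrict_Icc_le_abs_sub {a t : ℝ} (ht : 0 ≤ t) (hta : t ≤ a) :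
    ((volume.restrict (Set.Icc (-a) a)).prod (volume.restrict (Set.Icc (-a) a)))
      {p : ℝ × ℝ | 2 * t ≤ |p.1 - p.2|} = ENNReal.ofReal ((2 * a - 2 * t) ^ 2) := by
  have hmeas : MeasurableSet {p : ℝ × ℝ | 2 * t ≤ |p.1 - p.2|} :=
    measurableSet_le measurable_const (by fun_prop)
  rw [Measure.prod_apply hmeas]
  have hsection : ∀ x ∈ Set.Icc (-a) a,
      (volume.restrict (Set.Icc (-a) a)) (Prod.mk x ⁻¹' {p : ℝ × ℝ | 2 * t ≤ |p.1 - p.2|})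
        = ENNReal.ofReal (x - (2 * t - a)) + ENNReal.ofReal ((a - 2 * t) - x) := by
    intro x hx
    have hset : Prod.mk x ⁻¹' {p : ℝ × ℝ | 2 * t ≤ |p.1 - p.2|} ∩ Set.Icc (-a) a
        = Set.Icc (-a) (x - 2 * t) ∪ Set.Icc (x + 2 * t) a := by
      ext y
      have hx1 := hx.1
      have hx2 := hx.2
      simp only [Set.mem_inter_iff, Set.mem_preimage, Set.mem_ofPred_eq, Set.mem_Icc,
        Set.mem_union, le_abs]
      constructor
      · rintro ⟨h | h, h1, h2⟩
        · exact Or.inl ⟨h1, by linarith⟩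
        · exact Or.inr ⟨by linarith, h2⟩
      · rintro (⟨h1, h2⟩ | ⟨h1, h2⟩)
        · exact ⟨Or.inl (by linarith), h1, by linarith⟩
        · exact ⟨Or.inr (by linarith), by linarith, h2⟩
    have hdisj : AEDisjoint volume (Set.Icc (-a) (x - 2 * t)) (Set.Icc (x + 2 * t) a) := by
      refine measure_mono_null (t := {x}) ?_ (measure_singleton x)
      rintro y ⟨h1, h2⟩
      exact le_antisymm (by linarith [h1.2]) (by linarith [h2.1])
    rw [Measure.restrict_apply (measurable_prodMk_left hmeas), hset,
      measure_union₀ measurableSet_Icc.nullMeasurableSet hdisj, Real.volume_Icc, Real.volume_Icc]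
    congr 2 <;> ring
  rw [setLIntegral_congr_fun measurableSet_Icc hsection, lintegral_add_left (by fun_prop),
    setLIntegral_ofReal_sub_const (by linarith) (by linarith),
    setLIntegral_ofReal_const_sub (by linarith) (by linarith),
    ← ENNReal.ofReal_add (by positivity) (by positivity)]
  ring_nf

theorem stmt0 (a : ℝ) (ha : 0 < a) (ha' : a ≤ π / 2)
    (r : ℝ) (hr1 : 2 * Real.cos a ≤ r) (hr2 : r ≤ 2) :
    ((mu a).prod (mu a)) {p : ℝ × ℝ |
        ‖Complex.exp ((p.1 : ℂ) * Complex.I) + Complex.exp ((p.2 : ℂ) * Complex.I)‖ ≤ r}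
      = ENNReal.ofReal ((a - Real.arccos (r / 2)) ^ 2 / a ^ 2) := by
  have hcos : 0 ≤ Real.cos a := Real.cos_nonneg_of_mem_Icc ⟨by linarith [Real.pi_pos], ha'⟩
  have hta : Real.arccos (r / 2) ≤ a := by
    rw [← Real.arccos_cos ha.le (by linarith [Real.pi_pos])]
    exact Real.arccos_le_arccos (by linarith)
  have hae : {p : ℝ × ℝ |
        ‖Complex.exp ((p.1 : ℂ) * Complex.I) + Complex.exp ((p.2 : ℂ) * Complex.I)‖ ≤ r}
      =ᵐ[(volume.restrict (Set.Icc (-a) a)).prod (volume.restrict (Set.Icc (-a) a))]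
      {p : ℝ × ℝ | 2 * Real.arccos (r / 2) ≤ |p.1 - p.2|} := by
    rw [Measure.prod_restrict]
    filter_upwards [ae_restrict_mem (measurableSet_Icc.prod measurableSet_Icc)] with p hp
    obtain ⟨⟨h1, h2⟩, h3, h4⟩ := hp
    have hd : |p.1 - p.2| ≤ π := abs_le.2 ⟨by linarith, by linarith⟩
    refine propext ?_
    change ‖Complex.exp ((p.1 : ℂ) * Complex.I) + Complex.exp ((p.2 : ℂ) * Complex.I)‖ ≤ r ↔
      2 * Real.arccos (r / 2) ≤ |p.1 - p.2|
    rw [norm_exp_mul_I_add_exp_mul_I, two_mul_abs_cos_half_le_iff hd (by linarith) hr2]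
  rw [mu, Measure.prod_smul_left, Measure.prod_smul_right, Measure.smul_apply, Measure.smul_apply,
    measure_congr hae, restrict_prod_restrict_Icc_le_abs_sub (Real.arccos_nonneg _) hta,
    smul_eq_mul, smul_eq_mul, ← ENNReal.ofReal_inv_of_pos (by positivity),
    ← ENNReal.ofReal_mul (by positivity), ← ENNReal.ofReal_mul (by positivity)]
  congr 1
  field_simp
end

section
/- The pushforward of the product measure μ_a ⊗ μ_a under the map (φ₁, φ₂) ↦ (|e^{iφ₁} + e^{iφ₂}|, arg(e^{iφ₁} + e^{iφ₂})) ∈ ℝ² is absolutely continuous with respect to two-dimensional Lebesgue measure, with joint density g given by g(r, θ) = 1/(a² · √(4 − r²)) if |θ| ≤ a and 2·cos(a − |θ|) ≤ r < 2, and g(r, θ) = 0 otherwise. -/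
open MeasureTheory Real

/-- The joint density of radius and angle after two steps. -/
noncomputable def jointDensity (a : ℝ) (p : ℝ × ℝ) : ℝ :=
  if |p.2| ≤ a ∧ 2 * Real.cos (a - |p.2|) ≤ p.1 ∧ p.1 < 2 then
    1 / (a ^ 2 * Real.sqrt (4 - p.1 ^ 2))
  else 0

section PolarChange

open Set

/-- A measurable set in the plane that is symmetric about the diagonal has twice the area of its
part below the diagonal. -/
theorem volume_eq_two_mul_of_swap_invariant {A : Set (ℝ × ℝ)} (hA : MeasurableSet A)
    (hswap : ∀ p : ℝ × ℝ, p.swap ∈ A ↔ p ∈ A) :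
    volume A = 2 * volume (A ∩ {p : ℝ × ℝ | p.2 < p.1}) := by
  have hU : MeasurableSet {p : ℝ × ℝ | p.2 < p.1} := measurableSet_lt measurable_snd measurable_fst
  have hdiag : volume {p : ℝ × ℝ | p.1 = p.2} = 0 := by
    rw [Measure.volume_eq_prod,
      Measure.measure_prod_null (measurableSet_eq_fun measurable_fst measurable_snd)]
    refine Filter.Eventually.of_forall fun x => ?_
    have : Prod.mk x ⁻¹' {p : ℝ × ℝ | p.1 = p.2} = {x} := by
      ext y
      simp [eq_comm]
    simp [this]
  have hV : volume (A \ {p : ℝ × ℝ | p.2 < p.1}) = volume (A ∩ {p : ℝ × ℝ | p.2 < p.1}) := by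
    have hpre : Prod.swap ⁻¹' (A ∩ {p : ℝ × ℝ | p.2 < p.1}) = A ∩ {p : ℝ × ℝ | p.1 < p.2} := by
      ext p
      simp [hswap]
    have hmp : MeasurePreserving Prod.swap (volume : Measure (ℝ × ℝ)) volume :=
      Measure.measurePreserving_swap
    rw [← hmp.measure_preimage (hA.inter hU).nullMeasurableSet, hpre]
    apply le_antisymm
    · calc volume (A \ {p : ℝ × ℝ | p.2 < p.1})
          ≤ volume (A ∩ {p : ℝ × ℝ | p.1 < p.2} ∪ {p : ℝ × ℝ | p.1 = p.2}) := by
            refine measure_mono ?_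
            rintro p ⟨hp, hle⟩
            rcases (show p.1 ≤ p.2 from not_lt.mp hle).lt_or_eq with h | h
            · exact Or.inl ⟨hp, h⟩
            · exact Or.inr h
        _ ≤ volume (A ∩ {p : ℝ × ℝ | p.1 < p.2}) + volume {p : ℝ × ℝ | p.1 = p.2} :=
            measure_union_le _ _
        _ = volume (A ∩ {p : ℝ × ℝ | p.1 < p.2}) := by rw [hdiag, add_zero]
    · exact measure_mono fun p hp => ⟨hp.1, lt_asymm (show p.1 < p.2 from hp.2)⟩
  rw [← measure_inter_add_sdiff A hU, hV, two_mul]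

/-- The modulus and argument of `exp (i φ₁) + exp (i φ₂)`. -/
noncomputable def expSumPolar (p : ℝ × ℝ) : ℝ × ℝ :=
  (‖Complex.exp ((p.1 : ℂ) * Complex.I) + Complex.exp ((p.2 : ℂ) * Complex.I)‖,
    Complex.arg (Complex.exp ((p.1 : ℂ) * Complex.I) + Complex.exp ((p.2 : ℂ) * Complex.I)))

theorem measurable_expSumPolar : Measurable expSumPolar := by
  have h : Measurable fun p : ℝ × ℝ =>
      Complex.exp ((p.1 : ℂ) * Complex.I) + Complex.exp ((p.2 : ℂ) * Complex.I) := by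
    fun_prop
  exact h.norm.prodMk (Complex.measurable_arg.comp h)

theorem expSumPolar_swap (p : ℝ × ℝ) : expSumPolar p.swap = expSumPolar p := by
  simp [expSumPolar, add_comm]

theorem exp_add_exp_eq_two_cos_mul (θ ψ : ℝ) :
    Complex.exp (((θ + ψ : ℝ) : ℂ) * Complex.I) + Complex.exp (((θ - ψ : ℝ) : ℂ) * Complex.I) =
      ((2 * cos ψ : ℝ) : ℂ) * (Complex.cos θ + Complex.sin θ * Complex.I) := by
  simp only [Complex.exp_mul_I]
  push_cast
  rw [Complex.cos_add, Complex.cos_sub, Complex.sin_add, Complex.sin_sub]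
  ring

theorem expSumPolar_add_sub {θ ψ : ℝ} (hψ : |ψ| + |θ| ≤ π / 2) :
    expSumPolar (θ + ψ, θ - ψ) = (2 * cos ψ, θ) := by
  have hψ' := abs_le.mp (show |ψ| ≤ π / 2 by linarith [abs_nonneg θ])
  have hθ' := abs_le.mp (show |θ| ≤ π / 2 by linarith [abs_nonneg ψ])
  have hcos : 0 ≤ cos ψ := cos_nonneg_of_mem_Icc hψ'
  unfold expSumPolar
  simp only
  rw [exp_add_exp_eq_two_cos_mul]
  refine Prod.ext ?_ ?_
  · simp only
    rw [norm_mul, ← Complex.exp_mul_I, Complex.norm_exp_ofReal_mul_I, mul_one,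
      Complex.norm_real, norm_of_nonneg (by positivity)]
  · simp only
    rcases hcos.eq_or_lt with h | h
    · have hψeq : π / 2 ≤ |ψ| := by
        by_contra! hlt
        exact (cos_pos_of_mem_Ioo (abs_lt.mp hlt)).ne h
      have hθ : θ = 0 := abs_nonpos_iff.mp (by linarith)
      simp [← h, hθ]
    · exact Complex.arg_mul_cos_add_sin_mul_I (by positivity)
        ⟨by linarith [pi_pos], by linarith [pi_pos]⟩

/-- The angles `φ₁ ≥ φ₂` with mean `θ` for which `exp (i φ₁) + exp (i φ₂)` has modulus `r`. -/
noncomputable def anglesOfPolar (q : ℝ × ℝ) : ℝ × ℝ :=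
  (q.2 + arccos (q.1 / 2), q.2 - arccos (q.1 / 2))

/-- The support of the joint density. -/
def polarSupport (a : ℝ) : Set (ℝ × ℝ) :=
  {q | |q.2| ≤ a ∧ 2 * cos (a - |q.2|) ≤ q.1 ∧ q.1 < 2}

theorem mem_polarSupport {a : ℝ} {q : ℝ × ℝ} :
    q ∈ polarSupport a ↔ |q.2| ≤ a ∧ 2 * cos (a - |q.2|) ≤ q.1 ∧ q.1 < 2 :=
  Iff.rfl

theorem measurableSet_polarSupport (a : ℝ) : MeasurableSet (polarSupport a) := by
  have h1 : MeasurableSet {q : ℝ × ℝ | |q.2| ≤ a} :=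
    measurableSet_le (by fun_prop) (by fun_prop)
  have h2 : MeasurableSet {q : ℝ × ℝ | 2 * cos (a - |q.2|) ≤ q.1} :=
    measurableSet_le (by fun_prop) (by fun_prop)
  have h3 : MeasurableSet {q : ℝ × ℝ | q.1 < 2} := measurableSet_lt (by fun_prop) (by fun_prop)
  exact h1.inter (h2.inter h3)

variable {a : ℝ}

theorem fst_nonneg_of_mem_polarSupport (ha' : a ≤ π / 2) {q : ℝ × ℝ} (hq : q ∈ polarSupport a) :
    0 ≤ q.1 := by
  obtain ⟨h1, h2, -⟩ := hq
  have := cos_nonneg_of_mem_Icc (x := a - |q.2|)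
    ⟨by linarith [pi_pos], by linarith [abs_nonneg q.2]⟩
  linarith

theorem arccos_le_of_mem_polarSupport (ha' : a ≤ π / 2) {q : ℝ × ℝ} (hq : q ∈ polarSupport a) :
    arccos (q.1 / 2) ≤ a - |q.2| := by
  obtain ⟨h1, h2, -⟩ := hq
  calc arccos (q.1 / 2) ≤ arccos (cos (a - |q.2|)) := arccos_le_arccos (by linarith)
    _ = a - |q.2| := arccos_cos (by linarith) (by linarith [pi_pos, abs_nonneg q.2])

theorem expSumPolar_anglesOfPolar (ha' : a ≤ π / 2) {q : ℝ × ℝ} (hq : q ∈ polarSupport a) :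
    expSumPolar (anglesOfPolar q) = q := by
  have h0 := fst_nonneg_of_mem_polarSupport ha' hq
  have h1 := arccos_le_of_mem_polarSupport ha' hq
  have h2 := hq.2.2
  unfold anglesOfPolar
  rw [expSumPolar_add_sub (by rw [abs_of_nonneg (arccos_nonneg _)]; linarith),
    cos_arccos (by linarith) (by linarith)]
  ext <;> simp
  ring

theorem image_anglesOfPolar (ha' : a ≤ π / 2) :
    anglesOfPolar '' polarSupport a =
      (Icc (-a) a ×ˢ Icc (-a) a) ∩ {p : ℝ × ℝ | p.2 < p.1} := by
  ext p
  constructor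
  · rintro ⟨q, hq, rfl⟩
    have h1 := arccos_le_of_mem_polarSupport ha' hq
    have h2 := hq.2.2
    have h3 : 0 < arccos (q.1 / 2) := arccos_pos.mpr (by linarith)
    have h4 := neg_abs_le q.2
    have h5 := le_abs_self q.2
    simp only [anglesOfPolar, mem_inter_iff, mem_prod, mem_Icc, mem_ofPred_eq]
    refine ⟨⟨⟨?_, ?_⟩, ?_, ?_⟩, ?_⟩ <;> linarith
  · rintro ⟨⟨⟨h1, h2⟩, h3, h4⟩, h5⟩
    simp only [mem_ofPred_eq] at h5
    have hψ : arccos (cos ((p.1 - p.2) / 2)) = (p.1 - p.2) / 2 :=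
      arccos_cos (by linarith) (by linarith [pi_pos])
    have hθ : |(p.1 + p.2) / 2| ≤ a - (p.1 - p.2) / 2 :=
      abs_le.mpr ⟨by linarith, by linarith⟩
    refine ⟨(2 * cos ((p.1 - p.2) / 2), (p.1 + p.2) / 2), ⟨?_, ?_, ?_⟩, ?_⟩
    · simp only
      linarith
    · have := cos_le_cos_of_nonneg_of_le_pi (x := (p.1 - p.2) / 2)
        (y := a - |(p.1 + p.2) / 2|) (by linarith)
        (by linarith [pi_pos, abs_nonneg ((p.1 + p.2) / 2)]) (by linarith)
      simpa using this
    · have := cos_lt_cos_of_nonneg_of_le_pi (x := 0) (y := (p.1 - p.2) / 2) le_rfl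
        (by linarith [pi_pos]) (by linarith)
      rw [cos_zero] at this
      simp only
      linarith
    · simp only [anglesOfPolar, mul_div_cancel_left₀ _ (two_ne_zero' ℝ), hψ]
      ext <;> simp <;> ring

/-- The derivative of `anglesOfPolar`. -/
noncomputable def fderivAnglesOfPolar (q : ℝ × ℝ) : ℝ × ℝ →L[ℝ] ℝ × ℝ :=
  (Matrix.toLin (.finTwoProd ℝ) (.finTwoProd ℝ)
    !![-(1 / √(4 - q.1 ^ 2)), 1; 1 / √(4 - q.1 ^ 2), 1]).toContinuousLinearMap

theorem hasDerivAt_arccos_half {r : ℝ} (h0 : -2 < r) (h2 : r < 2) :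
    HasDerivAt (fun r => arccos (r / 2)) (-(1 / √(4 - r ^ 2))) r := by
  have h := (hasDerivAt_arccos (x := r / 2) (by linarith) (by linarith)).comp r
    ((hasDerivAt_id r).div_const 2)
  convert! h using 1
  have hs : √(4 - r ^ 2) = 2 * √(1 - (r / 2) ^ 2) := by
    rw [show 4 - r ^ 2 = 2 ^ 2 * (1 - (r / 2) ^ 2) by ring, sqrt_mul (by norm_num),
      sqrt_sq (by norm_num)]
  rw [hs, one_div, one_div, mul_inv]
  ring

theorem hasFDerivAt_anglesOfPolar {q : ℝ × ℝ} (h0 : -2 < q.1) (h2 : q.1 < 2) :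
    HasFDerivAt anglesOfPolar (fderivAnglesOfPolar q) q := by
  have h := (hasDerivAt_arccos_half h0 h2).comp_hasFDerivAt q
    (hasFDerivAt_fst (𝕜 := ℝ) (F := ℝ) (p := q))
  unfold fderivAnglesOfPolar
  rw [Matrix.toLin_finTwoProd_toContinuousLinearMap]
  convert! HasFDerivAt.prodMk (𝕜 := ℝ) (hasFDerivAt_snd.add h) (hasFDerivAt_snd.sub h) using 2 <;>
  simp [add_comm, sub_eq_add_neg, neg_smul _ (ContinuousLinearMap.fst ℝ ℝ ℝ)]

theorem abs_det_fderivAnglesOfPolar (q : ℝ × ℝ) :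
    |(fderivAnglesOfPolar q).det| = 2 / √(4 - q.1 ^ 2) := by
  unfold fderivAnglesOfPolar
  simp only [LinearMap.det_toContinuousLinearMap, LinearMap.det_toLin, Matrix.det_fin_two_of]
  rw [show -(1 / √(4 - q.1 ^ 2)) * 1 - 1 * (1 / √(4 - q.1 ^ 2)) = -(2 / √(4 - q.1 ^ 2)) by ring,
    abs_neg, abs_of_nonneg (by positivity)]

theorem volume_expSumPolar_preimage_lt (ha' : a ≤ π / 2) {s : Set (ℝ × ℝ)} (hs : MeasurableSet s) :
    volume ((Icc (-a) a ×ˢ Icc (-a) a) ∩ expSumPolar ⁻¹' s ∩ {p : ℝ × ℝ | p.2 < p.1}) =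
      ∫⁻ q in s ∩ polarSupport a, ENNReal.ofReal (2 / √(4 - q.1 ^ 2)) := by
  have himage : (Icc (-a) a ×ˢ Icc (-a) a) ∩ expSumPolar ⁻¹' s ∩ {p : ℝ × ℝ | p.2 < p.1} =
      anglesOfPolar '' (s ∩ polarSupport a) := by
    rw [inter_right_comm, ← image_anglesOfPolar ha']
    ext p
    constructor
    · rintro ⟨⟨q, hq, rfl⟩, hp⟩
      rw [mem_preimage, expSumPolar_anglesOfPolar ha' hq] at hp
      exact ⟨q, ⟨hp, hq⟩, rfl⟩
    · rintro ⟨q, ⟨hqs, hq⟩, rfl⟩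
      exact ⟨⟨q, hq, rfl⟩, by rwa [mem_preimage, expSumPolar_anglesOfPolar ha' hq]⟩
  have hinj : InjOn anglesOfPolar (s ∩ polarSupport a) := fun x hx y hy hxy => by
    rw [← expSumPolar_anglesOfPolar ha' hx.2, hxy, expSumPolar_anglesOfPolar ha' hy.2]
  rw [himage, ← lintegral_abs_det_fderiv_eq_addHaar_image volume
    (hs.inter (measurableSet_polarSupport a))
    (fun q hq => (hasFDerivAt_anglesOfPolar
      (by linarith [fst_nonneg_of_mem_polarSupport ha' hq.2]) hq.2.2.2).hasFDerivWithinAt) hinj]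
  simp only [abs_det_fderivAnglesOfPolar]

theorem mu_prod_mu (a : ℝ) :
    (mu a).prod (mu a) = ((ENNReal.ofReal (2 * a))⁻¹ * (ENNReal.ofReal (2 * a))⁻¹) •
      (volume : Measure (ℝ × ℝ)).restrict (Icc (-a) a ×ˢ Icc (-a) a) := by
  unfold mu
  rw [Measure.prod_smul_left, Measure.prod_smul_right, smul_smul, Measure.prod_restrict,
    Measure.volume_eq_prod]

theorem ofReal_jointDensity (ha : 0 < a) (q : ℝ × ℝ) :
    ENNReal.ofReal (jointDensity a q) =
      (polarSupport a).indicator (fun q => (ENNReal.ofReal (2 * a))⁻¹ *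
        (ENNReal.ofReal (2 * a))⁻¹ * 2 * ENNReal.ofReal (2 / √(4 - q.1 ^ 2))) q := by
  by_cases hq : q ∈ polarSupport a
  · have h2 : (2 : ENNReal) = ENNReal.ofReal 2 := by simp
    rw [indicator_of_mem hq, jointDensity, if_pos (mem_polarSupport.mp hq),
      ← ENNReal.ofReal_inv_of_pos (by positivity), h2, ← ENNReal.ofReal_mul (by positivity),
      ← ENNReal.ofReal_mul (by positivity),
      ← ENNReal.ofReal_mul (by positivity)]
    congr 1
    rw [one_div, mul_inv]
    field_simp
  · rw [indicator_of_notMem hq, jointDensity, if_neg (mem_polarSupport.not.mp hq),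
      ENNReal.ofReal_zero]

theorem map_expSumPolar (ha : 0 < a) (ha' : a ≤ π / 2) :
    Measure.map expSumPolar ((mu a).prod (mu a)) =
      (volume : Measure (ℝ × ℝ)).withDensity (fun p => ENNReal.ofReal (jointDensity a p)) := by
  ext s hs
  have hS : MeasurableSet (Icc (-a) a ×ˢ Icc (-a) a) := measurableSet_Icc.prod measurableSet_Icc
  have hm : MeasurableSet (expSumPolar ⁻¹' s) := measurable_expSumPolar hs
  have hswap : ∀ p : ℝ × ℝ, p.swap ∈ (Icc (-a) a ×ˢ Icc (-a) a) ∩ expSumPolar ⁻¹' s ↔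
      p ∈ (Icc (-a) a ×ˢ Icc (-a) a) ∩ expSumPolar ⁻¹' s := fun p => by
    simp only [mem_inter_iff, mem_preimage, expSumPolar_swap, mem_prod, Prod.fst_swap,
      Prod.snd_swap, and_comm (a := p.2 ∈ _)]
  rw [Measure.map_apply measurable_expSumPolar hs, mu_prod_mu, Measure.smul_apply,
    Measure.restrict_apply hm, inter_comm, volume_eq_two_mul_of_swap_invariant (hS.inter hm) hswap,
    volume_expSumPolar_preimage_lt ha' hs, withDensity_apply _ hs]
  simp only [ofReal_jointDensity ha]
  rw [setLIntegral_indicator (measurableSet_polarSupport a),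
    lintegral_const_mul _ (by fun_prop), smul_eq_mul, mul_assoc, inter_comm s]
  simp only [mul_assoc]

end PolarChange

theorem stmt4 (a : ℝ) (ha : 0 < a) (ha' : a ≤ π / 2) :
    (Measure.map
        (fun p : ℝ × ℝ =>
          (‖Complex.exp ((p.1 : ℂ) * Complex.I) + Complex.exp ((p.2 : ℂ) * Complex.I)‖,
           Complex.arg (Complex.exp ((p.1 : ℂ) * Complex.I) + Complex.exp ((p.2 : ℂ) * Complex.I))))
        ((mu a).prod (mu a))) ≪ (volume : Measure (ℝ × ℝ)) ∧
    (Measure.map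
        (fun p : ℝ × ℝ =>
          (‖Complex.exp ((p.1 : ℂ) * Complex.I) + Complex.exp ((p.2 : ℂ) * Complex.I)‖,
           Complex.arg (Complex.exp ((p.1 : ℂ) * Complex.I) + Complex.exp ((p.2 : ℂ) * Complex.I))))
        ((mu a).prod (mu a)))
      = (volume : Measure (ℝ × ℝ)).withDensity (fun p => ENNReal.ofReal (jointDensity a p)) := by
  refine ⟨?_, map_expSumPolar ha ha'⟩
  exact (map_expSumPolar ha ha').absolutelyContinuous.trans (withDensity_absolutelyContinuous _ _)
end

section
/- Fix θ with 0 ≤ θ < a, and let ν be the uniform probability measure on the interval [2θ − a, a]. Then for every real r with 2·cos(a − θ) ≤ r ≤ 2, the probability ν{φ ∈ ℝ : |e^{i(2θ − φ)} + e^{iφ}| ≤ r} equals 1 − arccos(r/2)/(a − θ). -/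
open MeasureTheory Real

/-- The uniform probability measure on the interval `[c, d]`:
Lebesgue measure restricted to `[c, d]`, normalized by `1/(d - c)`. -/
noncomputable def unif (c d : ℝ) : Measure ℝ :=
  (ENNReal.ofReal (d - c))⁻¹ • volume.restrict (Set.Icc c d)

/-- The sum of two points on the unit circle, at angles symmetric about `θ`, has modulus
`2 * |cos (φ - θ)|`. -/
lemma norm_exp_add_exp_reflect (θ φ : ℝ) :
    norm (Complex.exp (((2 * θ - φ : ℝ) : ℂ) * Complex.I) + Complex.exp ((φ : ℂ) * Complex.I))
      = 2 * |Real.cos (φ - θ)| := by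
  have h : Complex.exp (((2 * θ - φ : ℝ) : ℂ) * Complex.I) + Complex.exp ((φ : ℂ) * Complex.I)
      = Complex.exp ((θ : ℂ) * Complex.I) * ((2 * Real.cos (φ - θ) : ℝ) : ℂ) := by
    push_cast
    rw [Complex.two_cos, mul_add, ← Complex.exp_add, ← Complex.exp_add, add_comm]
    congr 2 <;> ring
  rw [h, norm_mul, Complex.norm_exp_ofReal_mul_I, one_mul, Complex.norm_real, Real.norm_eq_abs,
    abs_mul, abs_two]

lemma cos_le_iff_arccos_le_abs {x y : ℝ} (hx : |x| ≤ π) (hy : -1 ≤ y) (hy' : y ≤ 1) :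
    Real.cos x ≤ y ↔ Real.arccos y ≤ |x| := by
  conv_lhs => rw [← Real.cos_abs, ← Real.cos_arccos hy hy']
  exact Real.strictAntiOn_cos.le_iff_ge ⟨abs_nonneg x, hx⟩
    ⟨Real.arccos_nonneg y, Real.arccos_le_pi y⟩

theorem stmt6 (a : ℝ) (ha : 0 < a) (ha' : a ≤ π / 2)
    (θ : ℝ) (hθ1 : 0 ≤ θ) (hθ2 : θ < a)
    (r : ℝ) (hr1 : 2 * Real.cos (a - θ) ≤ r) (hr2 : r ≤ 2) :
    unif (2 * θ - a) a {φ : ℝ |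
        norm (Complex.exp (((2 * θ - φ : ℝ) : ℂ) * Complex.I)
          + Complex.exp ((φ : ℂ) * Complex.I)) ≤ r}
      = ENNReal.ofReal (1 - Real.arccos (r / 2) / (a - θ)) := by
  have hs : 0 < a - θ := sub_pos.2 hθ2
  have hcos : 0 ≤ Real.cos (a - θ) :=
    Real.cos_nonneg_of_neg_pi_div_two_le_of_le (by linarith [Real.pi_pos]) (by linarith)
  have ht0 : 0 ≤ Real.arccos (r / 2) := Real.arccos_nonneg _
  have hts : Real.arccos (r / 2) ≤ a - θ := by
    rw [← abs_of_pos hs, ← cos_le_iff_arccos_le_abs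
      (by rw [abs_of_pos hs]; linarith [Real.pi_pos]) (by linarith) (by linarith)]
    linarith
  have hcond : ∀ φ ∈ Set.Icc (2 * θ - a) a,
      2 * |Real.cos (φ - θ)| ≤ r ↔ Real.arccos (r / 2) ≤ |φ - θ| := by
    rintro φ ⟨h1, h2⟩
    have hφ : |φ - θ| ≤ π := abs_le.2 ⟨by linarith [Real.pi_pos], by linarith [Real.pi_pos]⟩
    rw [abs_of_nonneg (Real.cos_nonneg_of_neg_pi_div_two_le_of_le (by linarith) (by linarith)),
      ← cos_le_iff_arccos_le_abs hφ (by linarith) (by linarith), le_div_iff₀' two_pos]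
  simp_rw [norm_exp_add_exp_reflect]
  generalize Real.arccos (r / 2) = t at *
  have hset : {φ : ℝ | 2 * |Real.cos (φ - θ)| ≤ r} ∩ Set.Icc (2 * θ - a) a
      = Set.Icc (2 * θ - a) a \ Set.Ioo (θ - t) (θ + t) := by
    ext φ
    rw [Set.inter_comm, Set.mem_inter_iff, Set.mem_sdiff, Set.mem_ofPred_eq]
    refine and_congr_right fun hφ => ?_
    rw [hcond φ hφ, ← not_lt, abs_lt, Set.mem_Ioo, sub_lt_iff_lt_add', lt_sub_iff_add_lt',
      ← sub_eq_add_neg]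
  have hsub : Set.Ioo (θ - t) (θ + t) ⊆ Set.Icc (2 * θ - a) a :=
    fun φ hφ => ⟨by linarith [hφ.1], by linarith [hφ.2]⟩
  rw [unif, Measure.smul_apply, Measure.restrict_apply' measurableSet_Icc, hset,
    measure_sdiff hsub measurableSet_Ioo.nullMeasurableSet (by simp), Real.volume_Icc,
    Real.volume_Ioo, ← ENNReal.ofReal_sub _ (by linarith), smul_eq_mul,
    ← ENNReal.ofReal_inv_of_pos (by linarith), ← ENNReal.ofReal_mul
    (inv_nonneg.2 (by linarith))]
  congr 1
  have h2 : a - (2 * θ - a) = 2 * (a - θ) := by ring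
  rw [h2]
  field_simp
  ring
end

section
/- Let N ≥ 1 be an integer. Then every z ∈ S_N satisfies |z|² ≥ ⌈N/2⌉² + ⌊N/2⌋² + 2·⌊N/2⌋·⌈N/2⌉·cos(2a), and there exists z ∈ S_N attaining equality; that is, the minimum of |z| over z ∈ S_N equals √(⌈N/2⌉² + ⌊N/2⌋² + 2·⌊N/2⌋·⌈N/2⌉·cos(2a)). -/
open Real

/-- The set of points reachable by the `N`-step random walk with angles in `[-a, a]`. -/
def walkSupport (a : ℝ) (N : ℕ) : Set ℂ :=
  {z | ∃ φ : Fin N → ℝ, (∀ i, φ i ∈ Set.Icc (-a) a) ∧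
    z = ∑ i, Complex.exp ((φ i : ℂ) * Complex.I)}

/-- The squared norm of a sum of unit vectors, in coordinates. -/
lemma norm_sq_sum_exp {N : ℕ} (φ : Fin N → ℝ) :
    ‖∑ i, Complex.exp ((φ i : ℂ) * Complex.I)‖ ^ 2 =
      (∑ i, cos (φ i)) ^ 2 + (∑ i, sin (φ i)) ^ 2 := by
  rw [Complex.sq_norm, Complex.normSq_apply, Complex.re_sum, Complex.im_sum]
  simp only [Complex.exp_ofReal_mul_I_re, Complex.exp_ofReal_mul_I_im]
  ring

/-- The extremal value splits into its contributions along the two coordinate axes. -/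
lemma ceil_floor_sq_add_cos (a : ℝ) (N : ℕ) :
    (((N + 1) / 2 : ℕ) : ℝ) ^ 2 + ((N / 2 : ℕ) : ℝ) ^ 2
        + 2 * ((N / 2 : ℕ) : ℝ) * (((N + 1) / 2 : ℕ) : ℝ) * cos (2 * a)
      = ((N : ℝ) * cos a) ^ 2 + ((N % 2 : ℕ) : ℝ) * sin a ^ 2 := by
  rcases Nat.even_or_odd' N with ⟨k, rfl | rfl⟩
  · have h₁ : (2 * k + 1) / 2 = k := by lia
    have h₂ : 2 * k / 2 = k := by lia
    have h₃ : 2 * k % 2 = 0 := by lia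
    rw [h₁, h₂, h₃, cos_two_mul]
    push_cast
    ring
  · have h₁ : (2 * k + 1 + 1) / 2 = k + 1 := by lia
    have h₂ : (2 * k + 1) / 2 = k := by lia
    have h₃ : (2 * k + 1) % 2 = 1 := by lia
    rw [h₁, h₂, h₃, cos_two_mul, sin_sq]
    push_cast
    ring

lemma mod_two_le_sub_sq (p q : ℕ) : (((p + q) % 2 : ℕ) : ℝ) ≤ ((p : ℝ) - q) ^ 2 := by
  rcases Nat.mod_two_eq_zero_or_one (p + q) with h | h
  · rw [h]
    push_cast
    positivity
  · have hne : (p : ℤ) - q ≠ 0 := by lia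
    have hpos : (0 : ℤ) < ((p : ℤ) - q) ^ 2 := by positivity
    have hone : (1 : ℤ) ≤ ((p : ℤ) - q) ^ 2 := hpos
    rw [h]
    exact_mod_cast hone

/-- A lower bound for the squared norm of a sum of unit vectors, of which `p` have angle `a`,
`q` have angle `-a` and the remaining ones have arbitrary angles in `[-a, a]`. -/
lemma le_sq_add_sq_of_mem_Icc {a : ℝ} (ha : 0 ≤ a) (ha' : a ≤ π / 2) {n : ℕ} (φ : Fin n → ℝ)
    (hφ : ∀ i, φ i ∈ Set.Icc (-a) a) (p q : ℕ) :
    (((p + q + n : ℕ) : ℝ) * cos a) ^ 2 + (((p + q + n) % 2 : ℕ) : ℝ) * sin a ^ 2 ≤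
      ((p + q) * cos a + ∑ i, cos (φ i)) ^ 2 + ((p - q) * sin a + ∑ i, sin (φ i)) ^ 2 := by
  induction n generalizing p q with
  | zero =>
    have h := mul_le_mul_of_nonneg_right (mod_two_le_sub_sq p q) (sq_nonneg (sin a))
    simp only [Finset.univ_eq_empty, Finset.sum_empty, add_zero, mul_pow]
    push_cast at h ⊢
    linarith
  | succ n ih =>
    have ih' := ih (fun i => φ i.succ) fun i => hφ i.succ
    obtain ⟨hl, hu⟩ := hφ 0
    have hcos : cos a ≤ cos (φ 0) := by
      rw [← cos_abs (φ 0)]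
      exact cos_le_cos_of_nonneg_of_le_pi (abs_nonneg _) (by linarith [pi_pos])
        (abs_le.2 ⟨hl, hu⟩)
    have hsin : sin (φ 0) ≤ sin a :=
      sin_le_sin_of_le_of_le_pi_div_two (by linarith) ha' hu
    have hsin' : -sin a ≤ sin (φ 0) := by
      rw [← sin_neg]
      exact sin_le_sin_of_le_of_le_pi_div_two (by linarith) (by linarith) hl
    have hx : 0 ≤ ((p : ℝ) + q) * cos a + ∑ i : Fin n, cos (φ i.succ) :=
      add_nonneg (mul_nonneg (by positivity)
        (cos_nonneg_of_neg_pi_div_two_le_of_le (by linarith) ha'))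
        (Finset.sum_nonneg fun i _ => cos_nonneg_of_neg_pi_div_two_le_of_le
          (by linarith [(hφ i.succ).1]) (by linarith [(hφ i.succ).2]))
    have hxc := mul_nonneg hx (sub_nonneg.2 hcos)
    have hunit := sin_sq_add_cos_sq (φ 0)
    have hunit' := sin_sq_add_cos_sq a
    rw [Fin.sum_univ_succ, Fin.sum_univ_succ]
    rcases le_total 0 (((p : ℝ) - q) * sin a + ∑ i : Fin n, sin (φ i.succ)) with hy | hy
    · have hys := mul_nonneg hy (by linarith : 0 ≤ sin (φ 0) + sin a)
      have h := ih' p (q + 1)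
      rw [show p + (q + 1) + n = p + q + (n + 1) by ring] at h
      refine h.trans ?_
      push_cast
      linarith
    · have hys := mul_nonneg_of_nonpos_of_nonpos hy (by linarith : sin (φ 0) - sin a ≤ 0)
      have h := ih' (p + 1) q
      rw [show p + 1 + q + n = p + q + (n + 1) by ring] at h
      refine h.trans ?_
      push_cast
      linarith

/-- Alternating between the angles `a` and `-a` attains the extremal value. -/
lemma sum_alternating_sq_add_sq (a : ℝ) (N : ℕ) :
    (∑ i : Fin N, cos ((-1) ^ (i : ℕ) * a)) ^ 2 + (∑ i : Fin N, sin ((-1) ^ (i : ℕ) * a)) ^ 2 =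
      ((N : ℝ) * cos a) ^ 2 + ((N % 2 : ℕ) : ℝ) * sin a ^ 2 := by
  have hcos (i : ℕ) : cos ((-1) ^ i * a) = cos a := by
    rcases neg_one_pow_eq_or ℝ i with h | h <;> simp [h]
  have hsin (i : ℕ) : sin ((-1) ^ i * a) = (-1) ^ i * sin a := by
    rcases neg_one_pow_eq_or ℝ i with h | h <;> simp [h]
  simp only [hcos, hsin]
  rw [← Finset.sum_mul, Fin.sum_univ_eq_sum_range (fun i => (-1 : ℝ) ^ i), neg_one_geom_sum]
  rcases Nat.even_or_odd N with h | h
  · simp [h, Nat.even_iff.1 h]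
  · simp [Nat.not_even_iff_odd.2 h, Nat.odd_iff.1 h]

theorem stmt10 (a : ℝ) (ha : 0 < a) (ha' : a ≤ π / 2) (N : ℕ) (hN : 1 ≤ N) :
    (∀ z ∈ walkSupport a N,
      (((N + 1) / 2 : ℕ) : ℝ) ^ 2 + ((N / 2 : ℕ) : ℝ) ^ 2
        + 2 * ((N / 2 : ℕ) : ℝ) * (((N + 1) / 2 : ℕ) : ℝ) * Real.cos (2 * a)
        ≤ ‖z‖ ^ 2) ∧
    (∃ z ∈ walkSupport a N,
      ‖z‖ ^ 2
        = (((N + 1) / 2 : ℕ) : ℝ) ^ 2 + ((N / 2 : ℕ) : ℝ) ^ 2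
            + 2 * ((N / 2 : ℕ) : ℝ) * (((N + 1) / 2 : ℕ) : ℝ) * Real.cos (2 * a)) ∧
    IsLeast ((fun z : ℂ => ‖z‖) '' walkSupport a N)
      (Real.sqrt ((((N + 1) / 2 : ℕ) : ℝ) ^ 2 + ((N / 2 : ℕ) : ℝ) ^ 2
        + 2 * ((N / 2 : ℕ) : ℝ) * (((N + 1) / 2 : ℕ) : ℝ) * Real.cos (2 * a))) := by
  have lower : ∀ z ∈ walkSupport a N,
      ((N : ℝ) * cos a) ^ 2 + ((N % 2 : ℕ) : ℝ) * sin a ^ 2 ≤ ‖z‖ ^ 2 := by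
    rintro z ⟨φ, hφ, rfl⟩
    rw [norm_sq_sum_exp]
    simpa using le_sq_add_sq_of_mem_Icc ha.le ha' φ hφ 0 0
  have attained : ∃ z ∈ walkSupport a N,
      ‖z‖ ^ 2 = ((N : ℝ) * cos a) ^ 2 + ((N % 2 : ℕ) : ℝ) * sin a ^ 2 := by
    refine ⟨_, ⟨fun i => (-1) ^ (i : ℕ) * a, fun i => ?_, rfl⟩, ?_⟩
    · rcases neg_one_pow_eq_or ℝ (i : ℕ) with h | h <;> simp [h, ha.le]
    · rw [norm_sq_sum_exp, sum_alternating_sq_add_sq]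
  rw [ceil_floor_sq_add_cos]
  refine ⟨lower, attained, ?_, ?_⟩
  · obtain ⟨z, hz, h⟩ := attained
    exact ⟨z, hz, by rw [← h, sqrt_sq (norm_nonneg z)]⟩
  · rintro _ ⟨z, hz, rfl⟩
    exact sqrt_le_iff.2 ⟨norm_nonneg z, lower z hz⟩
end

section
/- Let N ≥ 2 be an even integer. Then every z ∈ S_N satisfies |z| ≥ N·cos a, and there exists z ∈ S_N with |z| = N·cos a; that is, the minimum of |z| over z ∈ S_N equals N·cos a. -/
open Real

/-- Every point of the support has real part at least `N cos a`. -/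
theorem mul_cos_le_re_of_mem_walkSupport {a : ℝ} (ha : a ≤ π) {N : ℕ} {z : ℂ}
    (hz : z ∈ walkSupport a N) : (N : ℝ) * Real.cos a ≤ z.re := by
  obtain ⟨φ, hφ, rfl⟩ := hz
  have hcos : ∀ i, Real.cos a ≤ Real.cos (φ i) := fun i => by
    rw [← Real.cos_abs (φ i)]
    exact Real.cos_le_cos_of_nonneg_of_le_pi (abs_nonneg _) ha (abs_le.2 (hφ i))
  simp only [Complex.re_sum, Complex.exp_ofReal_mul_I_re]
  simpa using Finset.sum_le_sum fun i (_ : i ∈ Finset.univ) => hcos i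

/-- Unit steps at angles alternating between `a` and `-a` add up to a real number. -/
theorem sum_range_exp_alternating (a : ℝ) (k : ℕ) :
    ∑ i ∈ Finset.range (k + k), Complex.exp ((((-1) ^ i * a : ℝ) : ℂ) * Complex.I) =
      (((k + k : ℕ) * Real.cos a : ℝ) : ℂ) := by
  induction k with
  | zero => simp
  | succ k ih =>
    rw [show k + 1 + (k + 1) = k + k + 1 + 1 by ring, Finset.sum_range_succ,
      Finset.sum_range_succ, ih, pow_succ, (Even.add_self k).neg_one_pow]
    apply Complex.ext
    · simp only [Complex.add_re, Complex.exp_ofReal_mul_I_re, Complex.ofReal_re]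
      push_cast
      simp only [one_mul, neg_mul, Real.cos_neg]
      ring
    · simp only [Complex.add_im, Complex.exp_ofReal_mul_I_im, Complex.ofReal_im]
      simp

/-- For even `N`, the real number `N cos a` lies in the support. -/
theorem mul_cos_mem_walkSupport {a : ℝ} (ha : 0 ≤ a) {N : ℕ} (hN : Even N) :
    (((N : ℝ) * Real.cos a : ℝ) : ℂ) ∈ walkSupport a N := by
  obtain ⟨k, rfl⟩ := hN
  refine ⟨fun i => (-1) ^ (i : ℕ) * a, fun i => ?_, ?_⟩
  · rw [Set.mem_Icc, ← abs_le, abs_mul, abs_neg_one_pow, one_mul, abs_of_nonneg ha]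
  · rw [Fin.sum_univ_eq_sum_range
      (fun i => Complex.exp ((((-1) ^ i * a : ℝ) : ℂ) * Complex.I)) (k + k),
      sum_range_exp_alternating]

theorem stmt11 (a : ℝ) (ha : 0 < a) (ha' : a ≤ π / 2)
    (N : ℕ) (hN : 2 ≤ N) (hNeven : Even N) :
    (∀ z ∈ walkSupport a N, (N : ℝ) * Real.cos a ≤ ‖z‖) ∧
    (∃ z ∈ walkSupport a N, ‖z‖ = (N : ℝ) * Real.cos a) ∧
    IsLeast ((fun z : ℂ => ‖z‖) '' walkSupport a N) ((N : ℝ) * Real.cos a) := by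
  have lower : ∀ z ∈ walkSupport a N, (N : ℝ) * Real.cos a ≤ ‖z‖ := fun z hz =>
    (mul_cos_le_re_of_mem_walkSupport (by linarith [Real.pi_pos]) hz).trans (Complex.re_le_norm z)
  have attained : ∃ z ∈ walkSupport a N, ‖z‖ = (N : ℝ) * Real.cos a := by
    refine ⟨_, mul_cos_mem_walkSupport ha.le hNeven, ?_⟩
    have hcos : 0 ≤ Real.cos a := Real.cos_nonneg_of_mem_Icc ⟨by linarith [Real.pi_pos], ha'⟩
    rw [Complex.norm_real, Real.norm_of_nonneg (by positivity)]
  exact ⟨lower, attained, attained, Set.forall_mem_image.2 fun z hz => lower z hz⟩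
end

section
/- Define F̄ : ℝ → ℝ by F̄(u) = min(1, max(0, (u + a)/(2a))). Let x > 0, let t ∈ [−a, a], and let r ≥ 0 be such that −1 ≤ (r² − x² − 1)/(2x) ≤ 1, and set A = arccos((r² − x² − 1)/(2x)). Then μ_a{ φ ∈ ℝ : |x·e^{it} + e^{iφ}| ≤ r } = 1 − ( F̄(t + A) − F̄(t − A) ). -/
open MeasureTheory Real

/-- The clipped CDF `F̄(u) = min(1, max(0, (u + a)/(2a)))` of the uniform distribution
on `[-a, a]`. -/
noncomputable def Fbar (a : ℝ) (u : ℝ) : ℝ := min 1 (max 0 ((u + a) / (2 * a)))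

/-- The law of cosines for the sum of two complex numbers of moduli `|x|` and `1`. -/
lemma sq_norm_mul_exp_add_exp (x t φ : ℝ) :
    ‖(x : ℂ) * Complex.exp ((t : ℂ) * Complex.I) + Complex.exp ((φ : ℂ) * Complex.I)‖ ^ 2
      = x ^ 2 + 1 + 2 * x * cos (φ - t) := by
  rw [← Complex.normSq_eq_norm_sq, Complex.normSq_apply]
  simp only [Complex.add_re, Complex.add_im, Complex.re_ofReal_mul, Complex.im_ofReal_mul,
    Complex.exp_ofReal_mul_I_re, Complex.exp_ofReal_mul_I_im]
  rw [cos_sub]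
  linear_combination x ^ 2 * sin_sq_add_cos_sq t + sin_sq_add_cos_sq φ

lemma norm_mul_exp_add_exp_le_iff {x r : ℝ} (hx : 0 < x) (hr : 0 ≤ r) (t φ : ℝ) :
    ‖(x : ℂ) * Complex.exp ((t : ℂ) * Complex.I) + Complex.exp ((φ : ℂ) * Complex.I)‖ ≤ r
      ↔ cos (φ - t) ≤ (r ^ 2 - x ^ 2 - 1) / (2 * x) := by
  rw [← sq_le_sq₀ (norm_nonneg _) hr, sq_norm_mul_exp_add_exp, le_div_iff₀ (by positivity)]
  constructor <;> intro h <;> linarith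

lemma cos_le_iff_arccos_le_abs_s16 {c u : ℝ} (h1 : -1 ≤ c) (h2 : c ≤ 1) (hu : |u| ≤ π) :
    cos u ≤ c ↔ arccos c ≤ |u| := by
  rw [← cos_abs u]
  nth_rw 1 [← cos_arccos h1 h2]
  exact strictAntiOn_cos.le_iff_ge ⟨abs_nonneg u, hu⟩ ⟨arccos_nonneg c, arccos_le_pi c⟩

/-- The uniform mass of the part of `[-a, a]` at distance at least `A` from `t`. -/
lemma mu_setOf_le_abs_sub {a t A : ℝ} (ha : 0 < a) (ht : t ∈ Set.Icc (-a) a) (hA : 0 ≤ A) :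
    mu a {φ : ℝ | A ≤ |φ - t|} = ENNReal.ofReal (1 - (Fbar a (t + A) - Fbar a (t - A))) := by
  obtain ⟨ht1, ht2⟩ := ht
  have hset : {φ : ℝ | A ≤ |φ - t|} ∩ Set.Icc (-a) a
      = Set.Icc (-a) (t - A) ∪ Set.Icc (t + A) a := by
    ext φ
    simp only [Set.mem_inter_iff, Set.mem_ofPred_eq, Set.mem_Icc, Set.mem_union, le_abs]
    grind
  have hdisj : AEDisjoint volume (Set.Icc (-a) (t - A)) (Set.Icc (t + A) a) := by
    refine measure_mono_null (t := {t}) ?_ (measure_singleton t)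
    rintro φ ⟨⟨_, h⟩, h', _⟩
    exact le_antisymm (by linarith) (by linarith)
  have hleft : Fbar a (t - A) = max 0 ((t - A + a) / (2 * a)) :=
    min_eq_right (max_le zero_le_one ((div_le_one (by positivity)).2 (by linarith)))
  have hright : 1 - Fbar a (t + A) = max 0 ((a - (t + A)) / (2 * a)) := by
    have h : (a - (t + A)) / (2 * a) = 1 - (t + A + a) / (2 * a) := by field_simp; ring
    rw [Fbar, max_eq_right (div_nonneg (by linarith) (by positivity)), h, ← max_sub_sub_left,
      sub_self]
  have hofReal (y : ℝ) :
      ENNReal.ofReal (max 0 (y / (2 * a))) = (ENNReal.ofReal (2 * a))⁻¹ * ENNReal.ofReal y := by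
    rw [ENNReal.ofReal_max, ENNReal.ofReal_zero, max_eq_right zero_le,
      ENNReal.ofReal_div_of_pos (by positivity), ENNReal.div_eq_inv_mul]
  rw [mu, Measure.smul_apply, Measure.restrict_apply' measurableSet_Icc, hset,
    measure_union₀ measurableSet_Icc.nullMeasurableSet hdisj, Real.volume_Icc, Real.volume_Icc,
    smul_eq_mul, mul_add, sub_neg_eq_add, ← hofReal, ← hofReal, ← hleft, ← hright,
    ← ENNReal.ofReal_add (hleft ▸ le_max_left _ _) (hright ▸ le_max_left _ _)]
  congr 1
  ring

theorem stmt16 (a : ℝ) (ha : 0 < a) (ha' : a ≤ π / 2)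
    (x : ℝ) (hx : 0 < x) (t : ℝ) (ht : t ∈ Set.Icc (-a) a)
    (r : ℝ) (hr : 0 ≤ r)
    (h1 : -1 ≤ (r ^ 2 - x ^ 2 - 1) / (2 * x)) (h2 : (r ^ 2 - x ^ 2 - 1) / (2 * x) ≤ 1) :
    mu a {φ : ℝ |
        ‖(x : ℂ) * Complex.exp ((t : ℂ) * Complex.I)
          + Complex.exp ((φ : ℂ) * Complex.I)‖ ≤ r}
      = ENNReal.ofReal
          (1 - (Fbar a (t + Real.arccos ((r ^ 2 - x ^ 2 - 1) / (2 * x)))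
              - Fbar a (t - Real.arccos ((r ^ 2 - x ^ 2 - 1) / (2 * x))))) := by
  rw [← mu_setOf_le_abs_sub ha ht (arccos_nonneg _), mu, Measure.smul_apply, Measure.smul_apply,
    Measure.restrict_apply' measurableSet_Icc, Measure.restrict_apply' measurableSet_Icc]
  congr 2
  ext φ
  simp only [Set.mem_inter_iff, Set.mem_ofPred_eq, and_congr_left_iff]
  rintro ⟨hφ1, hφ2⟩
  obtain ⟨ht1, ht2⟩ := ht
  rw [norm_mul_exp_add_exp_le_iff hx hr,
    cos_le_iff_arccos_le_abs_s16 h1 h2 (abs_le.2 ⟨by linarith, by linarith⟩)]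
end
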